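/- Let Γ be a countable discrete abelian group and (X, μ) a σ-finite measure space with L²(X) separable. Let σ : Γ × X → X be a measurable action (each σ_γ := σ(γ, ·) is measurable, σ_γ ∘ σ_{γ'} = σ_{γ+γ'}, and σ_e = id) which is quasi-Γ-invariant with measurable Jacobian J_σ : Γ × X → ℝ^+, i.e., dμ(σ_γ(x)) = J_σ(γ, x) dμ(x) for every γ ∈ Γ, and which satisfies the tiling property: there exists a measurable set C ⊆ X with μ(X \ ⋃_{γ∈Γ} σ_γ(C)) = 0 and μ(σ_γ(C) ∩ σ_{γ'}(C)) = 0 whenever γ ≠ γ'. Let T_σ(γ) be the associated unitary operators on L²(X), T_σ(γ)f(x) = J_σ(−γ, x)^{1/2} f(σ_{−γ}(x)). Given φ_1, …, φ_m ∈ L²(X), let V = closure of span{T_σ(γ)φ_j : γ ∈ Γ, 1 ≤ j ≤ m}, and suppose ℓ ≤ m is an integer such that there exist θ_1, …, θ_ℓ ∈ L²(X) with V = closure of span{T_σ(γ)θ_i : γ ∈ Γ, 1 ≤ i ≤ ℓ}. Consider the set R of matrices A = (a_{ij}) ∈ ℂ^{ℓ×m} such that V = closure of span{T_σ(γ)ψ_i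 : γ ∈ Γ, 1 ≤ i ≤ ℓ}, where ψ_i = Σ_{j=1}^m a_{ij} φ_j. Then ℂ^{ℓ×m} \ R has Lebesgue measure zero. -/

import Mathlib

open MeasureTheory

/-- The closed subspace of `L²(X)` spanned by `T_σ(γ) φⱼ`, `γ ∈ Γ`,
`1 ≤ j ≤ n`, where `T_σ(γ) f (x) = J_σ(−γ, x)^{1/2} f(σ_{−γ}(x))` (described
via a.e. representatives). -/
noncomputable def actSpan {Γ X : Type*} [AddCommGroup Γ] [MeasurableSpace X]
    (μ : Measure X) (σ : Γ → X → X) (Jσ : Γ → X → ℝ) {n : ℕ}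
    (φ : Fin n → Lp ℂ 2 μ) : Submodule ℂ (Lp ℂ 2 μ) :=
  (Submodule.span ℂ {F : Lp ℂ 2 μ | ∃ γ : Γ, ∃ j,
      (F : X → ℂ) =ᵐ[μ]
        fun x => (Real.sqrt (Jσ (-γ) x) : ℂ) * (φ j : X → ℂ) (σ (-γ) x)}).topologicalClosure

open scoped Pointwise ENNReal

universe u

/-- The group of characters of an additive abelian group, as a subgroup of `Γ → Circle`. -/
def dualSubgroup (Γ : Type*) [AddCommGroup Γ] : Subgroup (Γ → Circle) where
  carrier := {f | ∀ a b, f (a + b) = f a * f b}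
  mul_mem' {f g} hf hg a b := by simp [hf a b, hg a b, mul_mul_mul_comm]
  one_mem' a b := by simp
  inv_mem' {f} hf a b := by simp [hf a b, mul_comm]

theorem isClosed_dualSubgroup (Γ : Type*) [AddCommGroup Γ] :
    IsClosed (dualSubgroup Γ : Set (Γ → Circle)) := by
  have : (dualSubgroup Γ : Set (Γ → Circle)) = ⋂ a, ⋂ b, {f | f (a + b) = f a * f b} := by
    ext f; simp [dualSubgroup]
  rw [this]
  exact isClosed_iInter fun a => isClosed_iInter fun b =>
    isClosed_eq (by fun_prop) (by fun_prop)

theorem exists_mem_dualSubgroup_ne_one {Γ : Type*} [AddCommGroup Γ] {γ : Γ} (hγ : γ ≠ 0) :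
    ∃ f ∈ dualSubgroup Γ, f γ ≠ 1 := by
  obtain ⟨c, hc⟩ := CharacterModule.exists_character_apply_ne_zero_of_ne_zero hγ
  let ι : AddCircle (1 : ℚ) →+ AddCircle (1 : ℝ) :=
    QuotientAddGroup.map _ _ ((Rat.castHom ℝ : ℚ →+* ℝ).toAddMonoidHom) (by
      rintro x hx
      obtain ⟨n, rfl⟩ := AddSubgroup.mem_zmultiples_iff.mp hx
      exact AddSubgroup.mem_zmultiples_iff.mpr ⟨n, by simp⟩)
  have hι : ∀ x, ι x = 0 → x = 0 := by
    intro x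
    induction x using QuotientAddGroup.induction_on with
    | H q =>
      intro h
      rw [QuotientAddGroup.map_mk, QuotientAddGroup.eq_zero_iff] at h
      obtain ⟨n, hn⟩ := AddSubgroup.mem_zmultiples_iff.mp h
      rw [QuotientAddGroup.eq_zero_iff]
      refine AddSubgroup.mem_zmultiples_iff.mpr ⟨n, ?_⟩
      have : ((n : ℚ) : ℝ) = (q : ℝ) := by simpa using hn
      simpa using Rat.cast_injective this
  refine ⟨fun a => (ι (c a)).toCircle, fun a b => ?_, fun h => hc (hι _ ?_)⟩
  · change (ι (c (a + b))).toCircle = _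
    rw [map_add, map_add, AddCircle.toCircle_add]
  · apply AddCircle.injective_toCircle one_ne_zero
    rw [AddCircle.toCircle_zero]
    exact h

theorem ae_eq_zero_of_integral_mul_ofReal_eq_zero {Ω : Type*} [TopologicalSpace Ω]
    [PolishSpace Ω] [MeasurableSpace Ω] [BorelSpace Ω] (ν : Measure Ω)
    {A : StarSubalgebra ℂ (BoundedContinuousFunction Ω ℂ)}
    (hA : (A.map (BoundedContinuousFunction.toContinuousMapStarₐ ℂ)).SeparatesPoints)
    {g : Ω → ℝ} (hg : Integrable g ν) (h : ∀ χ ∈ A, ∫ ω, χ ω * (g ω : ℂ) ∂ν = 0) :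
    g =ᵐ[ν] 0 := by
  have hneg := hg.neg
  have hfin := isFiniteMeasure_withDensity_ofReal hg.2
  have hfin' := isFiniteMeasure_withDensity_ofReal hneg.2
  have key : (ν.withDensity fun ω => ENNReal.ofReal (g ω)) =
      ν.withDensity fun ω => ENNReal.ofReal ((-g) ω) := by
    refine ext_of_forall_mem_subalgebra_integral_eq_of_polish hA fun χ hχ => ?_
    rw [integral_withDensity_eq_integral_toReal_smul₀ hg.1.aemeasurable.ennreal_ofReal
        (by simp), integral_withDensity_eq_integral_toReal_smul₀
        hneg.1.aemeasurable.ennreal_ofReal (by simp), ← sub_eq_zero, ← integral_sub]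
    · rw [← h χ hχ]
      congr 1
      ext ω
      rw [← sub_smul, mul_comm, Complex.real_smul]
      congr 2
      rw [ENNReal.toReal_ofReal', ENNReal.toReal_ofReal', Pi.neg_apply]
      rcases le_total (g ω) 0 with h0 | h0 <;> simp [h0]
    · have hp : Integrable (fun ω => (ENNReal.ofReal (g ω)).toReal) ν := by
        simpa [ENNReal.toReal_ofReal'] using hg.pos_part
      exact hp.smul_bdd ‖χ‖ χ.continuous.aestronglyMeasurable (ae_of_all _ χ.norm_coe_le_norm)
    · have hp : Integrable (fun ω => (ENNReal.ofReal ((-g) ω)).toReal) ν := by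
        simpa [ENNReal.toReal_ofReal'] using hneg.pos_part
      exact hp.smul_bdd ‖χ‖ χ.continuous.aestronglyMeasurable (ae_of_all _ χ.norm_coe_le_norm)
  rw [withDensity_eq_iff hg.1.aemeasurable.ennreal_ofReal hneg.1.aemeasurable.ennreal_ofReal] at key
  · filter_upwards [key] with ω hω
    rcases le_total (g ω) 0 with h0 | h0
    · rw [ENNReal.ofReal_of_nonpos h0] at hω
      have := ENNReal.ofReal_eq_zero.mp hω.symm
      simp only [Pi.neg_apply] at this
      simp only [Pi.zero_apply]; linarith
    · rw [ENNReal.ofReal_of_nonpos (p := (-g) ω) (by simpa using h0)] at hω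
      have := ENNReal.ofReal_eq_zero.mp hω
      simp only [Pi.zero_apply]; linarith
  · exact hg.lintegral_lt_top.ne

theorem ae_eq_zero_of_integral_mul_eq_zero {Ω : Type*} [TopologicalSpace Ω]
    [PolishSpace Ω] [MeasurableSpace Ω] [BorelSpace Ω] (ν : Measure Ω)
    {A : StarSubalgebra ℂ (BoundedContinuousFunction Ω ℂ)}
    (hA : (A.map (BoundedContinuousFunction.toContinuousMapStarₐ ℂ)).SeparatesPoints)
    {g : Ω → ℂ} (hg : Integrable g ν) (h : ∀ χ ∈ A, ∫ ω, χ ω * g ω ∂ν = 0) :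
    g =ᵐ[ν] 0 := by
  have hint : ∀ (χ : BoundedContinuousFunction Ω ℂ) {f : Ω → ℂ}, Integrable f ν →
      Integrable (fun ω => χ ω * f ω) ν := fun χ f hf =>
    hf.bdd_mul (c := ‖χ‖) χ.continuous.aestronglyMeasurable (ae_of_all _ χ.norm_coe_le_norm)
  have hg' : Integrable (fun ω => (starRingEnd ℂ) (g ω)) ν := by
    simpa using (Complex.conjCLE.toContinuousLinearMap.integrable_comp hg)
  have hconj : ∀ χ ∈ A, ∫ ω, χ ω * (starRingEnd ℂ) (g ω) ∂ν = 0 := by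
    intro χ hχ
    have := congrArg (starRingEnd ℂ) (h (star χ) (star_mem hχ))
    rw [← integral_conj] at this
    simpa using this
  have hre : (fun ω => (g ω).re) =ᵐ[ν] 0 := by
    refine ae_eq_zero_of_integral_mul_ofReal_eq_zero ν hA hg.re fun χ hχ => ?_
    have e : ∀ ω, χ ω * ((g ω).re : ℂ) =
        (1 / 2) * (χ ω * g ω) + (1 / 2) * (χ ω * (starRingEnd ℂ) (g ω)) := fun ω => by
      rw [Complex.re_eq_add_conj]; ring
    simp_rw [e]
    rw [integral_add ((hint χ hg).const_mul _) ((hint χ hg').const_mul _),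
      integral_const_mul, integral_const_mul, h χ hχ, hconj χ hχ]
    simp
  have him : (fun ω => (g ω).im) =ᵐ[ν] 0 := by
    refine ae_eq_zero_of_integral_mul_ofReal_eq_zero ν hA hg.im fun χ hχ => ?_
    have e : ∀ ω, χ ω * ((g ω).im : ℂ) = (1 / (2 * Complex.I)) * (χ ω * g ω) -
        (1 / (2 * Complex.I)) * (χ ω * (starRingEnd ℂ) (g ω)) := fun ω => by
      rw [Complex.im_eq_sub_conj]; ring
    simp_rw [e]
    rw [integral_sub ((hint χ hg).const_mul _) ((hint χ hg').const_mul _),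
      integral_const_mul, integral_const_mul, h χ hχ, hconj χ hχ]
    simp
  filter_upwards [hre, him] with ω h1 h2
  exact Complex.ext h1 h2

/-- The evaluation character of the dual group at `γ`. -/
noncomputable def dualEval {Γ : Type*} [AddCommGroup Γ] (γ : Γ) :
    BoundedContinuousFunction (dualSubgroup Γ) ℂ :=
  BoundedContinuousFunction.ofNormedAddCommGroup (fun ω => ((ω.1 γ : Circle) : ℂ))
    ((show Continuous (fun z : Circle => (z : ℂ)) by fun_prop).comp
      ((continuous_apply γ).comp continuous_subtype_val)) 1
    (fun ω => (Circle.norm_coe _).le)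

theorem dualEval_apply {Γ : Type*} [AddCommGroup Γ] (γ : Γ) (ω : dualSubgroup Γ) :
    dualEval γ ω = ((ω.1 γ : Circle) : ℂ) := rfl

theorem dualEval_add {Γ : Type*} [AddCommGroup Γ] (γ γ' : Γ) :
    dualEval (γ + γ') = dualEval γ * dualEval γ' := by
  ext ω
  simp [dualEval_apply, ω.2 γ γ']

theorem dualEval_zero {Γ : Type*} [AddCommGroup Γ] : dualEval (0 : Γ) = 1 := by
  ext ω
  have h := ω.2 0 0
  simp only [add_zero, left_eq_mul] at h
  simp [dualEval_apply, h]

theorem star_dualEval {Γ : Type*} [AddCommGroup Γ] (γ : Γ) :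
    star (dualEval γ) = dualEval (-γ) := by
  ext ω
  have h : (1 : ℂ) = dualEval γ ω * dualEval (-γ) ω := by
    rw [← BoundedContinuousFunction.mul_apply, ← dualEval_add, add_neg_cancel, dualEval_zero]; rfl
  have h' : dualEval γ ω * star (dualEval γ ω) = 1 := by
    simp [dualEval_apply, Complex.mul_conj]
  have h0 : dualEval γ ω ≠ 0 := by simp [dualEval_apply]
  exact mul_left_cancel₀ h0 (h'.trans h)

/-- The algebra of trigonometric polynomials on the dual group. -/
noncomputable def dualTrigPoly (Γ : Type*) [AddCommGroup Γ] :
    StarSubalgebra ℂ (BoundedContinuousFunction (dualSubgroup Γ) ℂ) where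
  carrier := Submodule.span ℂ (Set.range (dualEval (Γ := Γ)))
  mul_mem' {a b} ha hb := by
    have hmul : Set.range (dualEval (Γ := Γ)) * Set.range (dualEval (Γ := Γ)) ⊆
        Set.range (dualEval (Γ := Γ)) := by
      rintro _ ⟨_, ⟨γ, rfl⟩, _, ⟨γ', rfl⟩, rfl⟩
      exact ⟨γ + γ', dualEval_add γ γ'⟩
    have := Submodule.mul_mem_mul ha hb
    rw [Submodule.span_mul_span] at this
    exact Submodule.span_mono hmul this
  add_mem' ha hb := Submodule.add_mem _ ha hb
  algebraMap_mem' r := by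
    rw [Algebra.algebraMap_eq_smul_one, ← dualEval_zero (Γ := Γ)]
    exact Submodule.smul_mem _ _ (Submodule.subset_span ⟨0, rfl⟩)
  star_mem' {a} ha := by
    induction ha using Submodule.span_induction with
    | mem x hx =>
      obtain ⟨γ, rfl⟩ := hx
      exact Submodule.subset_span ⟨-γ, (star_dualEval γ).symm⟩
    | zero => rw [star_zero]; exact Submodule.zero_mem _
    | add x y _ _ hx hy => rw [star_add]; exact Submodule.add_mem _ hx hy
    | smul c x _ hx => rw [star_smul]; exact Submodule.smul_mem _ _ hx

/-- A probability space carrying the characters of a countable discrete abelian group, with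
orthogonality and uniqueness of Fourier coefficients. -/
theorem exists_dual_measure (Γ : Type u) [AddCommGroup Γ] [Countable Γ] :
    ∃ (Ω : Type u) (_ : MeasurableSpace Ω) (ν : Measure Ω) (χ : Γ → Ω → ℂ),
      IsProbabilityMeasure ν ∧ (∀ γ, Measurable (χ γ)) ∧ (∀ γ ω, ‖χ γ ω‖ = 1) ∧
      (∀ γ γ' ω, χ (γ + γ') ω = χ γ ω * χ γ' ω) ∧ (∀ γ ≠ 0, ∫ ω, χ γ ω ∂ν = 0) ∧
      ∀ g : Ω → ℂ, Integrable g ν → (∀ γ, ∫ ω, χ γ ω * g ω ∂ν = 0) → g =ᵐ[ν] 0 := by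
  have : SecondCountableTopology Circle := inferInstance
  have : PolishSpace Circle := inferInstance
  have : PolishSpace (dualSubgroup Γ) := (isClosed_dualSubgroup Γ).polishSpace
  have : CompactSpace (dualSubgroup Γ) :=
    isCompact_iff_compactSpace.mp (isClosed_dualSubgroup Γ).isCompact
  let : MeasurableSpace (dualSubgroup Γ) := borel _
  have : BorelSpace (dualSubgroup Γ) := ⟨rfl⟩
  let ν : Measure (dualSubgroup Γ) := Measure.haarMeasure ⊤
  have hν : IsProbabilityMeasure ν := ⟨Measure.haarMeasure_self⟩
  refine ⟨dualSubgroup Γ, inferInstance, ν, fun γ => dualEval γ, hν,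
    fun γ => (dualEval γ).continuous.measurable, fun γ ω => Circle.norm_coe _,
    fun γ γ' ω => by simp only [dualEval_add]; rfl, fun γ hγ => ?_, fun g hg h => ?_⟩
  · obtain ⟨f, hf, hf1⟩ := exists_mem_dualSubgroup_ne_one hγ
    have h := integral_mul_left_eq_self (μ := ν) (fun ω => dualEval γ ω) ⟨f, hf⟩
    have e : ∀ ω, dualEval γ ((⟨f, hf⟩ : dualSubgroup Γ) * ω) = (f γ : ℂ) * dualEval γ ω :=
      fun ω => by simp [dualEval_apply]
    simp_rw [e] at h
    rw [integral_const_mul] at h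
    have h1 : ((f γ : ℂ) - 1) * ∫ ω, dualEval γ ω ∂ν = 0 := by rw [sub_mul, h, one_mul, sub_self]
    refine (mul_eq_zero.mp h1).resolve_left fun h0 => hf1 ?_
    exact Circle.ext (by simpa using sub_eq_zero.mp h0)
  · refine ae_eq_zero_of_integral_mul_eq_zero ν (A := dualTrigPoly Γ) ?_ hg fun χ hχ => ?_
    · intro x y hxy
      obtain ⟨γ, hγ⟩ : ∃ γ, x.1 γ ≠ y.1 γ := by
        by_contra! hc
        exact hxy (Subtype.ext (funext hc))
      refine ⟨_, ⟨(dualEval γ).toContinuousMap, ⟨dualEval γ,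
        Submodule.subset_span ⟨γ, rfl⟩, rfl⟩, rfl⟩, fun hc => hγ (Circle.ext hc)⟩
    · have hint : ∀ (χ : BoundedContinuousFunction (dualSubgroup Γ) ℂ),
          Integrable (fun ω => χ ω * g ω) ν := fun χ =>
        hg.bdd_mul (c := ‖χ‖) χ.continuous.aestronglyMeasurable
          (ae_of_all _ χ.norm_coe_le_norm)
      change χ ∈ Submodule.span ℂ (Set.range (dualEval (Γ := Γ))) at hχ
      induction hχ using Submodule.span_induction with
      | mem x hx => obtain ⟨γ, rfl⟩ := hx; exact h γ
      | zero => simp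
      | add x y _ _ hx hy =>
        simp only [BoundedContinuousFunction.coe_add, Pi.add_apply, add_mul]
        rw [integral_add (hint x) (hint y), hx, hy, add_zero]
      | smul c x _ hx =>
        simp only [BoundedContinuousFunction.coe_smul, smul_eq_mul, mul_assoc]
        rw [integral_const_mul, hx, mul_zero]

/-- Membership in the span of finitely many measurably varying vectors is a measurable condition. -/
theorem measurableSet_mem_span_range {Y E ι : Type*} [MeasurableSpace Y] [Fintype ι]
    [NormedAddCommGroup E] [NormedSpace ℂ E] {f : Y → E} {w : ι → Y → E}
    (hf : StronglyMeasurable f) (hw : ∀ i, StronglyMeasurable (w i)) :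
    MeasurableSet {y | f y ∈ Submodule.span ℂ (Set.range fun i => w i y)} := by
  have hset : {y | f y ∈ Submodule.span ℂ (Set.range fun i => w i y)} =
      ⋂ n : ℕ, ⋃ k : ℕ, {y | ‖f y - ∑ i, TopologicalSpace.denseSeq (ι → ℂ) k i • w i y‖
        < 1 / ((n : ℝ) + 1)} := by
    ext y
    simp only [Set.mem_ofPred_eq, Set.mem_iInter, Set.mem_iUnion]
    constructor
    · intro hy n
      obtain ⟨c, hc⟩ := (Submodule.mem_span_range_iff_exists_fun ℂ).mp hy
      have hcont : Continuous fun c : ι → ℂ => ‖f y - ∑ i, c i • w i y‖ := by fun_prop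
      have hopen := isOpen_lt hcont (continuous_const (y := 1 / ((n : ℝ) + 1)))
      exact (TopologicalSpace.denseRange_denseSeq (ι → ℂ)).exists_mem_open hopen
        ⟨c, by simp only [Set.mem_ofPred_eq, hc, sub_self, norm_zero]; positivity⟩
    · intro h
      have := FiniteDimensional.span_of_finite ℂ (Set.finite_range fun i => w i y)
      have hcl : IsClosed (Submodule.span ℂ (Set.range fun i => w i y) : Set E) :=
        Submodule.closed_of_finiteDimensional _
      refine hcl.closure_subset (Metric.mem_closure_iff.mpr fun ε hε => ?_)
      obtain ⟨n, hn⟩ := exists_nat_one_div_lt hε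
      obtain ⟨k, hk⟩ := h n
      exact ⟨∑ i, TopologicalSpace.denseSeq (ι → ℂ) k i • w i y,
        Submodule.sum_mem _ fun i _ => Submodule.smul_mem _ _ (Submodule.subset_span ⟨i, rfl⟩),
        by rw [dist_eq_norm]; exact hk.trans hn⟩
  rw [hset]
  refine MeasurableSet.iInter fun n => MeasurableSet.iUnion fun k => ?_
  refine measurableSet_lt ?_ measurable_const
  refine (hf.sub ?_).norm.measurable
  exact Finset.stronglyMeasurable_fun_sum _ fun i _ => (hw i).const_smul _

/-- Almost every choice of `n` vectors of `ℂᵐ` spans, together with a given subspace of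
codimension at most `n`, the whole space. -/
theorem ae_sup_span_range_eq_top (m n : ℕ) (N : Submodule ℂ (Fin m → ℂ))
    (hN : m ≤ Module.finrank ℂ N + n) :
    ∀ᵐ A : Fin n → Fin m → ℂ, N ⊔ Submodule.span ℂ (Set.range A) = ⊤ := by
  induction n generalizing N with
  | zero =>
    refine ae_of_all _ fun A => ?_
    have : N = ⊤ := Submodule.eq_top_of_finrank_eq
      (le_antisymm (Submodule.finrank_le _) (by simpa using hN))
    simp [this]
  | succ n ih =>
    by_cases hNt : N = ⊤
    · exact ae_of_all _ fun A => by simp [hNt]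
    have hae : ∀ᵐ z : (Fin m → ℂ) × (Fin n → Fin m → ℂ),
        N ⊔ Submodule.span ℂ {z.1} ⊔ Submodule.span ℂ (Set.range z.2) = ⊤ := by
      rw [Measure.volume_eq_prod, Measure.ae_prod_iff_ae_ae]
      · have hnull : ∀ᵐ a : Fin m → ℂ, a ∉ N := by
          have := Measure.addHaar_submodule volume (N.restrictScalars ℝ)
            (by simpa using hNt)
          exact measure_eq_zero_iff_ae_notMem.mp this
        filter_upwards [hnull] with a ha
        refine ih (N ⊔ Submodule.span ℂ {a}) ?_
        have hlt : N < N ⊔ Submodule.span ℂ {a} := by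
          refine lt_of_le_of_ne le_sup_left fun h => ha ?_
          rw [h]
          exact Submodule.mem_sup_right (Submodule.mem_span_singleton_self a)
        have := Submodule.finrank_lt_finrank_of_lt hlt
        omega
      · let b := Module.finBasis ℂ N
        let w : Fin (Module.finrank ℂ N) ⊕ Unit ⊕ Fin n →
            (Fin m → ℂ) × (Fin n → Fin m → ℂ) → (Fin m → ℂ) :=
          Sum.elim (fun i _ => (b i : Fin m → ℂ)) (Sum.elim (fun _ z => z.1) (fun i z => z.2 i))
        have hb : Submodule.span ℂ (Set.range fun i => (b i : Fin m → ℂ)) = N := by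
          have := congrArg (Submodule.map N.subtype) b.span_eq
          rwa [Submodule.map_span, ← Set.range_comp, Submodule.map_subtype_top] at this
        have hset : {z : (Fin m → ℂ) × (Fin n → Fin m → ℂ) |
            N ⊔ Submodule.span ℂ {z.1} ⊔ Submodule.span ℂ (Set.range z.2) = ⊤} =
            ⋂ k : Fin m, {z | (Pi.single k (1 : ℂ) : Fin m → ℂ) ∈
              Submodule.span ℂ (Set.range fun i => w i z)} := by
          ext z
          have hw : (fun i => w i z) = Sum.elim (fun i => (b i : Fin m → ℂ))
              (Sum.elim (fun _ : Unit => z.1) z.2) := by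
            ext i; rcases i with i | i | i <;> rfl
          simp only [Set.mem_ofPred_eq, Set.mem_iInter, hw, Set.Sum.elim_range,
            Submodule.span_union, hb, Set.range_const, ← sup_assoc]
          constructor
          · intro h k; rw [h]; trivial
          · intro h
            rw [eq_top_iff, ← (Pi.basisFun ℂ (Fin m)).span_eq, Submodule.span_le]
            rintro _ ⟨k, rfl⟩
            simpa using h k
        rw [hset]
        refine MeasurableSet.iInter fun k =>
          measurableSet_mem_span_range stronglyMeasurable_const fun i => ?_
        refine Measurable.stronglyMeasurable ?_
        rcases i with i | i | i
        · exact measurable_const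
        · exact measurable_fst
        · exact (measurable_pi_apply i).comp measurable_snd
    have hmp := volume_preserving_piFinSuccAbove (fun _ : Fin (n + 1) => Fin m → ℂ) 0
    filter_upwards [hmp.quasiMeasurePreserving.ae hae] with A hA
    have hr : Set.range A = {A 0} ∪ Set.range (Fin.tail A) := by
      ext x; simp [Fin.tail, Fin.exists_fin_succ, eq_comm]
    rw [hr, Submodule.span_union, ← sup_assoc]
    simpa [MeasurableEquiv.piFinSuccAbove_apply] using hA

/-- Generic linear combinations of vectors spanning a space of dimension at most `ℓ`. -/
theorem ae_forall_mem_span_range_sum {E : Type*} [AddCommGroup E] [Module ℂ E] {m ℓ : ℕ}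
    (v : Fin m → E) (hv : Module.finrank ℂ (Submodule.span ℂ (Set.range v)) ≤ ℓ) :
    ∀ᵐ A : Fin ℓ → Fin m → ℂ, ∀ j,
      v j ∈ Submodule.span ℂ (Set.range fun i => ∑ k, A i k • v k) := by
  let L := Fintype.linearCombination ℂ v
  have hrange : LinearMap.range L = Submodule.span ℂ (Set.range v) :=
    Fintype.range_linearCombination ℂ v
  have hdim := L.finrank_range_add_finrank_ker
  rw [hrange, Module.finrank_fin_fun] at hdim
  filter_upwards [ae_sup_span_range_eq_top m ℓ (LinearMap.ker L) (by omega)] with A hA j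
  have hker : Submodule.map L (LinearMap.ker L) = ⊥ := by
    rw [eq_bot_iff]
    rintro _ ⟨x, hx, rfl⟩
    exact hx
  have h := congrArg (Submodule.map L) hA
  rw [Submodule.map_sup, hker, bot_sup_eq, Submodule.map_span,
    ← Set.range_comp, Submodule.map_top, hrange] at h
  have : v j ∈ Submodule.span ℂ (Set.range v) := Submodule.subset_span ⟨j, rfl⟩
  rw [← h] at this
  exact this

section WeightedComp

variable {X E : Type*} [MeasurableSpace X] {μ : Measure X} [NormedAddCommGroup E]
  [NormedSpace ℂ E] {w : X → ℂ} {τ : X → X}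

theorem ae_eq_weightedComp (hw : Measurable w) (hτ : Measurable τ)
    (h : (μ.withDensity fun x => ‖w x‖ₑ ^ 2).map τ = μ) {f g : X → E} (hfg : f =ᵐ[μ] g) :
    (fun x => w x • f (τ x)) =ᵐ[μ] fun x => w x • g (τ x) := by
  rw [← h] at hfg
  have := ae_of_ae_map hτ.aemeasurable hfg
  rw [ae_withDensity_iff (by fun_prop)] at this
  filter_upwards [this] with x hx
  by_cases h0 : w x = 0
  · simp [h0]
  · rw [hx (by simpa using h0)]

theorem eLpNorm_weightedComp (hw : Measurable w) (hτ : Measurable τ)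
    (h : (μ.withDensity fun x => ‖w x‖ₑ ^ 2).map τ = μ) {f : X → E} (hf : StronglyMeasurable f) :
    eLpNorm (fun x => w x • f (τ x)) 2 μ = eLpNorm f 2 μ := by
  have key : ∫⁻ x, ‖w x • f (τ x)‖ₑ ^ 2 ∂μ = ∫⁻ x, ‖f x‖ₑ ^ 2 ∂μ := by
    conv_rhs => rw [← h]
    have hm : Measurable fun x => ‖f x‖ₑ ^ 2 := hf.enorm.pow_const _
    have hm' : Measurable fun x => ‖f (τ x)‖ₑ ^ 2 := hm.comp hτ
    rw [lintegral_map hm hτ, lintegral_withDensity_eq_lintegral_mul _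
      (show Measurable fun x => ‖w x‖ₑ ^ 2 by fun_prop) hm']
    simp [enorm_smul, mul_pow]
  rw [eLpNorm_eq_lintegral_rpow_enorm_toReal (by simp) (by simp),
    eLpNorm_eq_lintegral_rpow_enorm_toReal (by simp) (by simp)]
  simpa using congrArg (· ^ (2⁻¹ : ℝ)) key

theorem memLp_weightedComp (hw : Measurable w) (hτ : Measurable τ)
    (h : (μ.withDensity fun x => ‖w x‖ₑ ^ 2).map τ = μ) (f : Lp E 2 μ) :
    MemLp (fun x => w x • f (τ x)) 2 μ := by
  refine ⟨(hw.stronglyMeasurable.smul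
    ((Lp.stronglyMeasurable f).comp_measurable hτ)).aestronglyMeasurable, ?_⟩
  rw [eLpNorm_weightedComp hw hτ h (Lp.stronglyMeasurable f)]
  exact Lp.eLpNorm_lt_top f

/-- The isometry `f ↦ w • (f ∘ τ)` of `L²`, where `τ` carries the measure `|w|² μ` to `μ`. -/
noncomputable def weightedComp (E : Type*) [NormedAddCommGroup E] [NormedSpace ℂ E]
    (hw : Measurable w) (hτ : Measurable τ)
    (h : (μ.withDensity fun x => ‖w x‖ₑ ^ 2).map τ = μ) : Lp E 2 μ →ₗᵢ[ℂ] Lp E 2 μ where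
  toFun f := MemLp.toLp (fun x => w x • f (τ x)) (memLp_weightedComp hw hτ h f)
  map_add' f g := by
    rw [← MemLp.toLp_add]
    refine MemLp.toLp_congr _ _ ((ae_eq_weightedComp hw hτ h (Lp.coeFn_add f g)).trans ?_)
    exact ae_of_all _ fun x => by simp
  map_smul' c f := by
    rw [RingHom.id_apply, ← MemLp.toLp_const_smul]
    refine MemLp.toLp_congr _ _ ((ae_eq_weightedComp hw hτ h (Lp.coeFn_smul c f)).trans ?_)
    exact ae_of_all _ fun x => by simp [smul_comm c]
  norm_map' f := by
    change ‖MemLp.toLp _ (memLp_weightedComp hw hτ h f)‖ = _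
    rw [Lp.norm_toLp, eLpNorm_weightedComp hw hτ h (Lp.stronglyMeasurable f), Lp.norm_def]

theorem coeFn_weightedComp (hw : Measurable w) (hτ : Measurable τ)
    (h : (μ.withDensity fun x => ‖w x‖ₑ ^ 2).map τ = μ) (f : Lp E 2 μ) :
    weightedComp E hw hτ h f =ᵐ[μ] fun x => w x • f (τ x) :=
  MemLp.coeFn_toLp (memLp_weightedComp hw hτ h f)

end WeightedComp

section OrbitSpan

variable {Γ H K : Type*} [NormedAddCommGroup H] [InnerProductSpace ℂ H]
  [NormedAddCommGroup K] [InnerProductSpace ℂ K]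

/-- The closed span of the orbits of finitely many vectors. -/
noncomputable def orbitSpan (T : Γ → H →ₗᵢ[ℂ] H) {n : ℕ} (φ : Fin n → H) : Submodule ℂ H :=
  (Submodule.span ℂ (Set.range fun p : Γ × Fin n => T p.1 (φ p.2))).topologicalClosure

theorem map_orbitSpan [CompleteSpace H] (T : Γ → H →ₗᵢ[ℂ] H) (S : Γ → K →ₗᵢ[ℂ] K)
    (U : H →ₗᵢ[ℂ] K) (hU : ∀ γ f, U (T γ f) = S γ (U f)) {n : ℕ} (φ : Fin n → H) :
    (orbitSpan T φ).map U.toLinearMap = orbitSpan S fun i => U (φ i) := by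
  apply SetLike.coe_injective
  rw [orbitSpan, orbitSpan, Submodule.map_coe, Submodule.topologicalClosure_coe,
    Submodule.topologicalClosure_coe]
  change U '' _ = _
  rw [← U.isometry.isClosedEmbedding.closure_image_eq]
  congr 1
  change (Submodule.map U.toLinearMap _ : Set K) = _
  rw [Submodule.map_span, ← Set.range_comp]
  congr 2
  ext p
  simp [hU]

theorem orbitSpan_sum_le (T : Γ → H →ₗᵢ[ℂ] H) {m n : ℕ} (φ : Fin m → H) (A : Fin n → Fin m → ℂ) :
    orbitSpan T (fun i => ∑ j, A i j • φ j) ≤ orbitSpan T φ := by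
  refine Submodule.topologicalClosure_mono (Submodule.span_le.mpr ?_)
  rintro _ ⟨p, rfl⟩
  simp only [map_sum, map_smul]
  exact Submodule.sum_mem _ fun j _ =>
    Submodule.smul_mem _ _ (Submodule.subset_span ⟨(p.1, j), rfl⟩)

end OrbitSpan

section Fiber

variable {Γ Ω E : Type*} [MeasurableSpace Ω] {ν : Measure Ω}
  [NormedAddCommGroup E] [InnerProductSpace ℂ E]

theorem map_id_withDensity_of_norm_eq_one {w : Ω → ℂ} (hw1 : ∀ ω, ‖w ω‖ = 1) :
    (ν.withDensity fun x => ‖w x‖ₑ ^ 2).map id = ν := by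
  have : (fun x => ‖w x‖ₑ ^ 2) = 1 := by
    ext x
    rw [← ofReal_norm, hw1]; simp
  rw [this, withDensity_one, Measure.map_id]

/-- Pointwise multiplication by a unimodular function, as an isometry of `L²(Ω; E)`. -/
noncomputable def unimodularMul (ν : Measure Ω) (E : Type*) [NormedAddCommGroup E]
    [InnerProductSpace ℂ E] {w : Ω → ℂ} (hw : Measurable w) (hw1 : ∀ ω, ‖w ω‖ = 1) :
    Lp E 2 ν →ₗᵢ[ℂ] Lp E 2 ν :=
  weightedComp E hw measurable_id (map_id_withDensity_of_norm_eq_one hw1)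

theorem coeFn_unimodularMul {w : Ω → ℂ} (hw : Measurable w) (hw1 : ∀ ω, ‖w ω‖ = 1)
    (f : Lp E 2 ν) : unimodularMul ν E hw hw1 f =ᵐ[ν] fun ω => w ω • f ω :=
  coeFn_weightedComp hw measurable_id _ f

variable {χ : Γ → Ω → ℂ} (hχ : ∀ γ, Measurable (χ γ)) (hχ1 : ∀ γ ω, ‖χ γ ω‖ = 1)

theorem ae_mem_span_of_mem_orbitSpan {n : ℕ} {F : Fin n → Lp E 2 ν} {g : Lp E 2 ν}
    (hg : g ∈ orbitSpan (fun γ => unimodularMul ν E (hχ γ) (hχ1 γ)) F) :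
    ∀ᵐ ω ∂ν, g ω ∈ Submodule.span ℂ (Set.range fun j => F j ω) := by
  let S : Submodule ℂ (Lp E 2 ν) :=
    { carrier := {g | ∀ᵐ ω ∂ν, g ω ∈ Submodule.span ℂ (Set.range fun j => F j ω)}
      add_mem' := by
        intro a b ha hb
        filter_upwards [ha, hb, Lp.coeFn_add a b] with ω h1 h2 h3
        rw [h3]; exact Submodule.add_mem _ h1 h2
      zero_mem' := by
        filter_upwards [Lp.coeFn_zero E 2 ν] with ω h
        rw [h]; exact Submodule.zero_mem _
      smul_mem' := by
        intro c a ha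
        filter_upwards [ha, Lp.coeFn_smul c a] with ω h1 h2
        rw [h2]; exact Submodule.smul_mem _ _ h1 }
  have hS : IsClosed (S : Set (Lp E 2 ν)) := by
    refine IsSeqClosed.isClosed fun u g hu hlim => ?_
    obtain ⟨ns, -, hns⟩ := (tendstoInMeasure_of_tendsto_Lp hlim).exists_seq_tendsto_ae
    filter_upwards [hns, ae_all_iff.mpr hu] with ω h1 h2
    have := FiniteDimensional.span_of_finite ℂ (Set.finite_range fun j => F j ω)
    have hcl : IsClosed (Submodule.span ℂ (Set.range fun j => F j ω) : Set E) :=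
      Submodule.closed_of_finiteDimensional _
    exact hcl.mem_of_tendsto h1 (Filter.Eventually.of_forall fun i => h2 (ns i))
  refine Submodule.topologicalClosure_minimal _ (Submodule.span_le.mpr ?_) hS hg
  rintro _ ⟨p, rfl⟩
  filter_upwards [coeFn_unimodularMul (hχ p.1) (hχ1 p.1) (F p.2)] with ω h
  rw [h]
  exact Submodule.smul_mem _ _ (Submodule.subset_span ⟨p.2, rfl⟩)

theorem ae_inner_eq_zero_of_forall_inner_unimodularMul_eq_zero
    (huniq : ∀ g : Ω → ℂ, Integrable g ν → (∀ γ, ∫ ω, χ γ ω * g ω ∂ν = 0) → g =ᵐ[ν] 0)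
    {f g : Lp E 2 ν} (h : ∀ γ, inner ℂ f (unimodularMul ν E (hχ γ) (hχ1 γ) g) = 0) :
    ∀ᵐ ω ∂ν, inner ℂ (f ω) (g ω) = 0 := by
  refine huniq _ (L2.integrable_inner f g) fun γ => ?_
  rw [← h γ, L2.inner_def]
  refine integral_congr_ae ?_
  filter_upwards [coeFn_unimodularMul (hχ γ) (hχ1 γ) g] with ω h
  rw [h, inner_smul_right]

theorem coeFn_sum_smul {m : ℕ} (F : Fin m → Lp E 2 ν) (c : Fin m → ℂ) :
    ((∑ j, c j • F j : Lp E 2 ν) : Ω → E) =ᵐ[ν] fun ω => ∑ j, c j • F j ω := by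
  have : ∀ s : Finset (Fin m),
      ((∑ j ∈ s, c j • F j : Lp E 2 ν) : Ω → E) =ᵐ[ν] fun ω => ∑ j ∈ s, c j • F j ω := by
    intro s
    induction s using Finset.induction_on with
    | empty =>
      simp only [Finset.sum_empty]
      exact Lp.coeFn_zero E 2 ν
    | insert a s ha ih =>
      rw [Finset.sum_insert ha]
      filter_upwards [Lp.coeFn_add (c a • F a) (∑ j ∈ s, c j • F j), ih,
        Lp.coeFn_smul (c a) (F a)] with ω h1 h2 h3
      rw [h1, Pi.add_apply, h2, h3, Finset.sum_insert ha, Pi.smul_apply]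
  exact this _

/-- The genericity statement in the fibered model, where `Γ` acts by multiplication by
characters. -/
theorem ae_orbitSpan_unimodularMul_eq [SFinite ν] [CompleteSpace E]
    (huniq : ∀ g : Ω → ℂ, Integrable g ν → (∀ γ, ∫ ω, χ γ ω * g ω ∂ν = 0) → g =ᵐ[ν] 0)
    {m ℓ : ℕ} (F : Fin m → Lp E 2 ν) (Θ : Fin ℓ → Lp E 2 ν)
    (hF : ∀ j, F j ∈ orbitSpan (fun γ => unimodularMul ν E (hχ γ) (hχ1 γ)) Θ) :
    ∀ᵐ A : Fin ℓ → Fin m → ℂ,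
      orbitSpan (fun γ => unimodularMul ν E (hχ γ) (hχ1 γ)) (fun i => ∑ j, A i j • F j) =
        orbitSpan (fun γ => unimodularMul ν E (hχ γ) (hχ1 γ)) F := by
  have hpt : ∀ᵐ A : Fin ℓ → Fin m → ℂ, ∀ᵐ ω ∂ν, ∀ j,
      F j ω ∈ Submodule.span ℂ (Set.range fun i => ∑ k, A i k • F k ω) := by
    rw [Measure.ae_ae_comm]
    · filter_upwards [ae_all_iff.mpr fun j => ae_mem_span_of_mem_orbitSpan hχ hχ1 (hF j)] with ω hω
      refine ae_forall_mem_span_range_sum (fun j => F j ω) ?_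
      have := FiniteDimensional.span_of_finite ℂ (Set.finite_range fun i => Θ i ω)
      refine (Submodule.finrank_mono (Submodule.span_le.mpr ?_)).trans
        ((finrank_range_le_card (R := ℂ) fun i => Θ i ω).trans (by simp))
      rintro _ ⟨j, rfl⟩
      exact hω j
    · rw [show {x : (Fin ℓ → Fin m → ℂ) × Ω | ∀ j,
          F j x.2 ∈ Submodule.span ℂ (Set.range fun i => ∑ k, x.1 i k • F k x.2)} =
          ⋂ j, {x | F j x.2 ∈ Submodule.span ℂ (Set.range fun i => ∑ k, x.1 i k • F k x.2)} by
        ext; simp]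
      have hFm : ∀ j, StronglyMeasurable fun x : (Fin ℓ → Fin m → ℂ) × Ω => F j x.2 := fun j =>
        (Lp.stronglyMeasurable (F j)).comp_measurable measurable_snd
      refine MeasurableSet.iInter fun j => measurableSet_mem_span_range (hFm j) fun i => ?_
      refine Finset.stronglyMeasurable_fun_sum _ fun k _ => StronglyMeasurable.smul ?_ (hFm k)
      exact Measurable.stronglyMeasurable (by fun_prop)
  filter_upwards [hpt] with A hA
  refine le_antisymm (orbitSpan_sum_le _ _ _) fun g hg => ?_
  set W := orbitSpan (fun γ => unimodularMul ν E (hχ γ) (hχ1 γ)) (fun i => ∑ j, A i j • F j)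
    with hW
  have : CompleteSpace W := (Submodule.isClosed_topologicalClosure _).completeSpace_coe
  obtain ⟨p, hp, q, hq, rfl⟩ := W.exists_add_mem_mem_orthogonal g
  have hqF : q ∈ orbitSpan (fun γ => unimodularMul ν E (hχ γ) (hχ1 γ)) F := by
    simpa using Submodule.sub_mem _ hg (orbitSpan_sum_le _ _ _ hp)
  have horth : ∀ i, ∀ᵐ ω ∂ν, inner ℂ (q ω) ((∑ j, A i j • F j : Lp E 2 ν) ω) = 0 := fun i =>
    ae_inner_eq_zero_of_forall_inner_unimodularMul_eq_zero hχ hχ1 huniq fun γ => by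
      have hmem : unimodularMul ν E (hχ γ) (hχ1 γ) (∑ j, A i j • F j) ∈ W :=
        Submodule.le_topologicalClosure _ (Submodule.subset_span ⟨(γ, i), rfl⟩)
      exact Submodule.inner_left_of_mem_orthogonal hmem hq
  have hq0 : q = 0 := by
    rw [Lp.eq_zero_iff_ae_eq_zero]
    filter_upwards [hA, ae_mem_span_of_mem_orbitSpan hχ hχ1 hqF, ae_all_iff.mpr horth,
      ae_all_iff.mpr fun i => coeFn_sum_smul F (A i)] with ω h1 h2 h3 h4
    have hmem : q ω ∈ Submodule.span ℂ (Set.range fun i => ∑ k, A i k • F k ω) := by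
      refine Submodule.span_le.mpr ?_ h2
      rintro _ ⟨j, rfl⟩
      exact h1 j
    have hperp : Submodule.span ℂ (Set.range fun i => ∑ k, A i k • F k ω) ≤
        (Submodule.span ℂ {q ω})ᗮ := by
      refine Submodule.span_le.mpr ?_
      rintro _ ⟨i, rfl⟩
      rw [SetLike.mem_coe, Submodule.mem_orthogonal_singleton_iff_inner_right]
      have := h3 i
      rwa [h4 i] at this
    have := Submodule.mem_orthogonal_singleton_iff_inner_right.mp (hperp hmem)
    exact inner_self_eq_zero.mp this
  rw [hq0, add_zero]
  exact hp

end Fiber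

section Wandering

variable {Γ : Type u} {H : Type*} [AddCommGroup Γ] [NormedAddCommGroup H] [InnerProductSpace ℂ H]

/-- Constant functions, as an isometric embedding of `E` into `L²(Ω; E)`. -/
noncomputable def constIsometry {Ω : Type*} [MeasurableSpace Ω] (ν : Measure Ω)
    [IsProbabilityMeasure ν] (E : Type*) [NormedAddCommGroup E] [InnerProductSpace ℂ E] :
    E →ₗᵢ[ℂ] Lp E 2 ν where
  toLinearMap := Lp.constₗ 2 ν ℂ
  norm_map' c := by simp [Lp.norm_const']

theorem orthogonalFamily_unimodularMul_const {Ω E : Type*} [MeasurableSpace Ω] {ν : Measure Ω}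
    [IsProbabilityMeasure ν] [NormedAddCommGroup E] [InnerProductSpace ℂ E] [CompleteSpace E]
    {χ : Γ → Ω → ℂ} (hχ : ∀ γ, Measurable (χ γ)) (hχ1 : ∀ γ ω, ‖χ γ ω‖ = 1)
    (hadd : ∀ γ γ' ω, χ (γ + γ') ω = χ γ ω * χ γ' ω) (hint : ∀ γ ≠ 0, ∫ ω, χ γ ω ∂ν = 0) :
    OrthogonalFamily ℂ (fun _ : Γ => E)
      fun γ => (unimodularMul ν E (hχ γ) (hχ1 γ)).comp (constIsometry ν E) := by
  intro γ γ' hne v w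
  rw [L2.inner_def]
  have hconj : ∀ ω, χ γ' ω * starRingEnd ℂ (χ γ ω) = χ (γ' - γ) ω := fun ω => by
    have h := hadd (γ' - γ) γ ω
    rw [sub_add_cancel] at h
    rw [h, mul_assoc, Complex.mul_conj, Complex.normSq_eq_norm_sq, hχ1]
    simp
  have : ∀ᵐ ω ∂ν, inner ℂ (((unimodularMul ν E (hχ γ) (hχ1 γ)).comp (constIsometry ν E) v) ω)
      (((unimodularMul ν E (hχ γ') (hχ1 γ')).comp (constIsometry ν E) w) ω) =
      χ (γ' - γ) ω * inner ℂ v w := by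
    filter_upwards [coeFn_unimodularMul (hχ γ) (hχ1 γ) (constIsometry ν E v),
      coeFn_unimodularMul (hχ γ') (hχ1 γ') (constIsometry ν E w),
      Lp.coeFn_const (p := 2) (μ := ν) v,
      Lp.coeFn_const (p := 2) (μ := ν) w] with ω h1 h2 h3 h4
    change constIsometry ν E v ω = _ at h3
    change constIsometry ν E w ω = _ at h4
    change inner ℂ (unimodularMul ν E (hχ γ) (hχ1 γ) (constIsometry ν E v) ω)
      (unimodularMul ν E (hχ γ') (hχ1 γ') (constIsometry ν E w) ω) = _
    rw [h1, h2, h3, h4, inner_smul_left,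
      inner_smul_right, ← hconj]
    simp only [Function.const_apply]
    ring
  rw [integral_congr_ae this, integral_mul_const, hint _ (sub_ne_zero.mpr hne.symm), zero_mul]

theorem ae_orbitSpan_eq_of_wandering [Countable Γ] [CompleteSpace H] (T : Γ → H →ₗᵢ[ℂ] H)
    (hT0 : ∀ f, T 0 f = f) (hT : ∀ γ γ' f, T γ (T γ' f) = T (γ + γ') f)
    (K : Submodule ℂ H) [CompleteSpace K]
    (horth : OrthogonalFamily ℂ (fun _ : Γ => K) fun γ => (T γ).comp K.subtypeₗᵢ)
    (htotal : ∀ f, (∀ γ, ∀ k ∈ K, inner ℂ (T γ k) f = 0) → f = 0)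
    {m ℓ : ℕ} (φ : Fin m → H) (θ : Fin ℓ → H) (hφθ : orbitSpan T φ = orbitSpan T θ) :
    ∀ᵐ A : Fin ℓ → Fin m → ℂ, orbitSpan T (fun i => ∑ j, A i j • φ j) = orbitSpan T φ := by
  classical
  obtain ⟨Ω, _, ν, χ, hν, hχ, hχ1, hadd, hint, huniq⟩ := exists_dual_measure Γ
  have hdense : (⨆ γ, LinearMap.range ((T γ).comp K.subtypeₗᵢ).toLinearMap).topologicalClosure
      = ⊤ := by
    rw [Submodule.topologicalClosure_eq_top_iff, Submodule.eq_bot_iff]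
    intro f hf
    refine htotal f fun γ k hk => ?_
    have hmem : T γ k ∈ LinearMap.range ((T γ).comp K.subtypeₗᵢ).toLinearMap :=
      ⟨⟨k, hk⟩, rfl⟩
    exact Submodule.inner_right_of_mem_orthogonal (Submodule.mem_iSup_of_mem γ hmem) hf
  have hsum : IsHilbertSum ℂ (fun _ : Γ => K) fun γ => (T γ).comp K.subtypeₗᵢ :=
    IsHilbertSum.mk horth hdense.ge
  have horth' := orthogonalFamily_unimodularMul_const (ν := ν) (E := K) hχ hχ1 hadd hint
  let U : H →ₗᵢ[ℂ] Lp K 2 ν :=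
    horth'.linearIsometry.comp hsum.linearIsometryEquiv.toLinearIsometry
  let M : Γ → Lp K 2 ν →ₗᵢ[ℂ] Lp K 2 ν := fun γ => unimodularMul ν K (hχ γ) (hχ1 γ)
  have hUK : ∀ γ (k : K), U (T γ k) = M γ (constIsometry ν K k) := by
    intro γ k
    have h1 : hsum.linearIsometryEquiv (T γ k) = lp.single 2 γ k := by
      rw [← LinearIsometryEquiv.eq_symm_apply]
      exact (hsum.linearIsometryEquiv_symm_apply_single (i := γ) k).symm
    change horth'.linearIsometry (hsum.linearIsometryEquiv (T γ k)) = _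
    rw [h1]
    exact horth'.linearIsometry_apply_single (i := γ) k
  have hM : ∀ γ γ' f, M γ (M γ' f) = M (γ + γ') f := by
    intro γ γ' f
    refine Lp.ext ?_
    filter_upwards [coeFn_unimodularMul (hχ γ) (hχ1 γ) (M γ' f),
      coeFn_unimodularMul (hχ γ') (hχ1 γ') f,
      coeFn_unimodularMul (hχ (γ + γ')) (hχ1 (γ + γ')) f] with ω h1 h2 h3
    rw [h1, h2, h3, hadd, mul_smul]
  have hU : ∀ γ f, U (T γ f) = M γ (U f) := by
    intro γ
    let S : Submodule ℂ H := LinearMap.eqLocus (U.comp (T γ)).toLinearMap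
      ((M γ).comp U).toLinearMap
    have hS : IsClosed (S : Set H) :=
      isClosed_eq (U.comp (T γ)).continuous ((M γ).comp U).continuous
    have hle : ⨆ γ, LinearMap.range ((T γ).comp K.subtypeₗᵢ).toLinearMap ≤ S := by
      refine iSup_le fun γ' => ?_
      rintro _ ⟨k, rfl⟩
      change U (T γ (T γ' k)) = M γ (U (T γ' k))
      rw [hT, hUK, hUK, hM]
    intro f
    have := Submodule.topologicalClosure_minimal _ hle hS
    rw [hdense] at this
    exact this (Submodule.mem_top (x := f))
  have hinj := Submodule.map_injective_of_injective (f := U.toLinearMap) U.injective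
  have hmem : ∀ j, U (φ j) ∈ orbitSpan M fun i => U (θ i) := by
    intro j
    rw [← map_orbitSpan T M U hU, ← hφθ]
    refine Submodule.mem_map_of_mem (Submodule.le_topologicalClosure _ (Submodule.subset_span ?_))
    exact ⟨(0, j), hT0 _⟩
  filter_upwards [ae_orbitSpan_unimodularMul_eq hχ hχ1 huniq (fun j => U (φ j)) _ hmem] with A hA
  apply hinj
  rw [map_orbitSpan T M U hU, map_orbitSpan T M U hU]
  simpa only [map_sum, map_smul] using hA

end Wandering

section Action

variable {Γ : Type u} {X : Type*} [AddCommGroup Γ] [MeasurableSpace X] {μ : Measure X}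
  {σ : Γ → X → X} {Jσ : Γ → X → ℝ}

/-- A measurable action with Jacobian `Jσ` with respect to `μ`. -/
structure IsQuasiInvariantAction (μ : Measure X) (σ : Γ → X → X) (Jσ : Γ → X → ℝ) : Prop where
  measurable : ∀ γ, Measurable (σ γ)
  comp : ∀ γ γ' x, σ γ (σ γ' x) = σ (γ + γ') x
  id : ∀ x, σ 0 x = x
  measurable_jacobian : ∀ γ, Measurable (Jσ γ)
  pos : ∀ γ x, 0 < Jσ γ x
  map_neg : ∀ γ, μ.map (σ (-γ)) = μ.withDensity fun x => ENNReal.ofReal (Jσ γ x)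

namespace IsQuasiInvariantAction

theorem map_eq (h : IsQuasiInvariantAction μ σ Jσ) (γ : Γ) :
    μ.map (σ γ) = μ.withDensity fun x => ENNReal.ofReal (Jσ (-γ) x) := by
  simpa using h.map_neg (-γ)

theorem apply_neg_apply (h : IsQuasiInvariantAction μ σ Jσ) (γ : Γ) (x : X) :
    σ γ (σ (-γ) x) = x := by
  rw [h.comp, add_neg_cancel, h.id]

theorem apply_apply_neg (h : IsQuasiInvariantAction μ σ Jσ) (γ : Γ) (x : X) :
    σ (-γ) (σ γ x) = x := by
  rw [h.comp, neg_add_cancel, h.id]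

theorem mem_image_iff (h : IsQuasiInvariantAction μ σ Jσ) (γ : Γ) (C : Set X) (x : X) :
    x ∈ σ γ '' C ↔ σ (-γ) x ∈ C := by
  constructor
  · rintro ⟨y, hy, rfl⟩
    rwa [h.apply_apply_neg]
  · exact fun hx => ⟨_, hx, h.apply_neg_apply γ x⟩

theorem quasiMeasurePreserving (h : IsQuasiInvariantAction μ σ Jσ) (γ : Γ) :
    Measure.QuasiMeasurePreserving (σ γ) μ μ :=
  ⟨h.measurable γ, by rw [h.map_eq]; exact withDensity_absolutelyContinuous _ _⟩

theorem map_map_neg (h : IsQuasiInvariantAction μ σ Jσ) (γ : Γ) :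
    (μ.map (σ γ)).map (σ (-γ)) = μ := by
  rw [Measure.map_map (h.measurable _) (h.measurable _)]
  convert Measure.map_id
  ext x
  exact h.apply_apply_neg γ x

theorem map_withDensity_weight (h : IsQuasiInvariantAction μ σ Jσ) (γ : Γ) :
    (μ.withDensity fun x => ‖(Real.sqrt (Jσ (-γ) x) : ℂ)‖ₑ ^ 2).map (σ (-γ)) = μ := by
  have hw : ∀ x, ‖(Real.sqrt (Jσ (-γ) x) : ℂ)‖ₑ ^ 2 = ENNReal.ofReal (Jσ (-γ) x) := by
    intro x
    rw [← ofReal_norm, ← ENNReal.ofReal_pow (norm_nonneg _), Complex.norm_real, Real.norm_eq_abs,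
      sq_abs, Real.sq_sqrt (h.pos _ _).le]
  simp_rw [hw]
  rw [← h.map_eq, h.map_map_neg]

theorem measurable_weight (h : IsQuasiInvariantAction μ σ Jσ) (γ : Γ) :
    Measurable fun x => (Real.sqrt (Jσ (-γ) x) : ℂ) := by
  have := h.measurable_jacobian (-γ)
  fun_prop

theorem jacobian_cocycle (h : IsQuasiInvariantAction μ σ Jσ) [SigmaFinite μ] (γ γ' : Γ) :
    ∀ᵐ x ∂μ, Jσ (-γ) x * Jσ (-γ') (σ (-γ) x) = Jσ (-(γ + γ')) x := by
  have hm : Measurable fun x => ENNReal.ofReal (Jσ (-γ') (σ (-γ) x)) :=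
    ((h.measurable_jacobian _).comp (h.measurable _)).ennreal_ofReal
  have hmγ := (h.measurable_jacobian (-γ)).ennreal_ofReal
  have key : μ.withDensity (fun x => ENNReal.ofReal (Jσ (-γ) x) *
      ENNReal.ofReal (Jσ (-γ') (σ (-γ) x))) =
      μ.withDensity fun x => ENNReal.ofReal (Jσ (-(γ + γ')) x) := by
    rw [← h.map_eq, show σ (γ + γ') = σ γ ∘ σ γ' from funext fun x => (h.comp _ _ _).symm,
      ← Measure.map_map (h.measurable _) (h.measurable _), h.map_eq γ']
    change μ.withDensity ((fun x => ENNReal.ofReal (Jσ (-γ) x)) *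
      fun x => ENNReal.ofReal (Jσ (-γ') (σ (-γ) x))) = _
    rw [withDensity_mul _ hmγ hm, ← h.map_eq]
    ext s hs
    rw [Measure.map_apply (h.measurable _) hs, withDensity_apply _ hs,
      withDensity_apply _ (h.measurable γ hs), setLIntegral_map hs hm (h.measurable _)]
    simp_rw [h.apply_apply_neg]
  have hae := (withDensity_eq_iff_of_sigmaFinite (hmγ.mul hm).aemeasurable
    (h.measurable_jacobian _).ennreal_ofReal.aemeasurable).mp key
  filter_upwards [hae] with x hx
  rw [Pi.mul_apply, ← ENNReal.ofReal_mul (h.pos _ _).le] at hx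
  exact (ENNReal.ofReal_eq_ofReal_iff (mul_pos (h.pos _ _) (h.pos _ _)).le (h.pos _ _).le).mp hx

/-- The operator `f ↦ J_σ(-γ, ·)^{1/2} f(σ_{-γ}(·))` on `L²`. -/
noncomputable def isometry (h : IsQuasiInvariantAction μ σ Jσ) (γ : Γ) :
    Lp ℂ 2 μ →ₗᵢ[ℂ] Lp ℂ 2 μ :=
  weightedComp ℂ (h.measurable_weight γ) (h.measurable (-γ)) (h.map_withDensity_weight γ)

theorem coeFn_isometry (h : IsQuasiInvariantAction μ σ Jσ) (γ : Γ) (f : Lp ℂ 2 μ) :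
    h.isometry γ f =ᵐ[μ] fun x => (Real.sqrt (Jσ (-γ) x) : ℂ) * f (σ (-γ) x) :=
  coeFn_weightedComp _ _ _ f

theorem actSpan_eq_orbitSpan (h : IsQuasiInvariantAction μ σ Jσ) {n : ℕ} (φ : Fin n → Lp ℂ 2 μ) :
    actSpan μ σ Jσ φ = orbitSpan h.isometry φ := by
  rw [actSpan, orbitSpan]
  congr 2
  ext F
  constructor
  · rintro ⟨γ, j, hF⟩
    exact ⟨(γ, j), Lp.ext ((h.coeFn_isometry γ (φ j)).trans hF.symm)⟩
  · rintro ⟨p, rfl⟩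
    exact ⟨p.1, p.2, h.coeFn_isometry p.1 (φ p.2)⟩

theorem isometry_isometry (h : IsQuasiInvariantAction μ σ Jσ)
    [SigmaFinite μ] (γ γ' : Γ) (f : Lp ℂ 2 μ) :
    h.isometry γ (h.isometry γ' f) = h.isometry (γ + γ') f := by
  refine Lp.ext ?_
  filter_upwards [h.coeFn_isometry γ (h.isometry γ' f), h.coeFn_isometry (γ + γ') f,
    (h.quasiMeasurePreserving (-γ)).ae (h.coeFn_isometry γ' f), h.jacobian_cocycle γ γ']
    with x h1 h2 h3 h4
  rw [h1, h2, h3, ← h4, Real.sqrt_mul (h.pos _ _).le, h.comp, neg_add_rev]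
  push_cast
  ring

theorem isometry_zero (h : IsQuasiInvariantAction μ σ Jσ) [SigmaFinite μ] (f : Lp ℂ 2 μ) :
    h.isometry 0 f = f :=
  (h.isometry 0).injective (by rw [h.isometry_isometry, add_zero])

end IsQuasiInvariantAction

/-- The `L²` functions vanishing almost everywhere outside `C`. -/
noncomputable def supportedOn (μ : Measure X) (C : Set X) : Submodule ℂ (Lp ℂ 2 μ) :=
  LinearMap.ker (LpToLpRestrictCLM X ℂ ℂ μ 2 Cᶜ).toLinearMap

theorem mem_supportedOn_iff {C : Set X} (hC : MeasurableSet C) (f : Lp ℂ 2 μ) :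
    f ∈ supportedOn μ C ↔ ∀ᵐ x ∂μ, x ∉ C → f x = 0 := by
  change LpToLpRestrictCLM X ℂ ℂ μ 2 Cᶜ f = 0 ↔ _
  rw [Lp.eq_zero_iff_ae_eq_zero]
  have hr := LpToLpRestrictCLM_coeFn ℂ Cᶜ f
  change _ ↔ ∀ᵐ x ∂μ, x ∈ Cᶜ → f x = 0
  rw [← ae_restrict_iff' hC.compl]
  exact ⟨fun h => hr.symm.trans h, fun h => hr.trans h⟩

instance (C : Set X) : CompleteSpace (supportedOn μ C) :=
  (LpToLpRestrictCLM X ℂ ℂ μ 2 Cᶜ).isClosed_ker.completeSpace_coe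

namespace IsQuasiInvariantAction

variable {C : Set X}

theorem orthogonalFamily_supportedOn (h : IsQuasiInvariantAction μ σ Jσ) (hC : MeasurableSet C)
    (hdisj : ∀ γ γ' : Γ, γ ≠ γ' → μ (σ γ '' C ∩ σ γ' '' C) = 0) :
    OrthogonalFamily ℂ (fun _ : Γ => supportedOn μ C)
      fun γ => (h.isometry γ).comp (supportedOn μ C).subtypeₗᵢ := by
  intro γ γ' hne v w
  change inner ℂ (h.isometry γ v) (h.isometry γ' w) = 0
  rw [L2.inner_def]
  refine integral_eq_zero_of_ae ?_
  have hd : ∀ᵐ x ∂μ, x ∉ σ γ '' C ∩ σ γ' '' C := measure_eq_zero_iff_ae_notMem.mp (hdisj _ _ hne)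
  filter_upwards [h.coeFn_isometry γ v, h.coeFn_isometry γ' w, hd,
    (h.quasiMeasurePreserving (-γ)).ae ((mem_supportedOn_iff hC _).mp v.2),
    (h.quasiMeasurePreserving (-γ')).ae ((mem_supportedOn_iff hC _).mp w.2)] with x h1 h2 h3 h4 h5
  rw [Set.mem_inter_iff, h.mem_image_iff, h.mem_image_iff, not_and_or] at h3
  rw [h1, h2]
  rcases h3 with h3 | h3
  · simp [h4 h3]
  · simp [h5 h3]

theorem eq_zero_of_orthogonal_supportedOn (h : IsQuasiInvariantAction μ σ Jσ)
    (hC : MeasurableSet C) [SigmaFinite μ] [Countable Γ]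
    (hcover : μ ((⋃ γ : Γ, σ γ '' C)ᶜ) = 0) (f : Lp ℂ 2 μ)
    (hf : ∀ γ, ∀ k ∈ supportedOn μ C, inner ℂ (h.isometry γ k) f = 0) : f = 0 := by
  have hzero : ∀ γ, ∀ᵐ x ∂μ, σ (-γ) x ∈ C → f x = 0 := by
    intro γ
    set g := h.isometry (-γ) f with hg
    have hfg : h.isometry γ g = f := by
      rw [hg, h.isometry_isometry, add_neg_cancel, h.isometry_zero]
    have hmem := (Lp.memLp g).indicator hC
    have hk := hmem.coeFn_toLp
    have hkC : hmem.toLp ∈ supportedOn μ C := by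
      rw [mem_supportedOn_iff hC]
      filter_upwards [hk] with x hx hxC
      rw [hx, Set.indicator_of_notMem hxC]
    have hinner := hf γ _ hkC
    rw [← hfg, LinearIsometry.inner_map_map] at hinner
    have hself : inner ℂ hmem.toLp hmem.toLp = 0 := by
      rw [← hinner, L2.inner_def, L2.inner_def]
      refine integral_congr_ae ?_
      filter_upwards [hk] with x hx
      rw [hx]
      by_cases hxC : x ∈ C <;> simp [hxC]
    have hk0 := (Lp.eq_zero_iff_ae_eq_zero).mp (inner_self_eq_zero.mp hself)
    have hgC : ∀ᵐ x ∂μ, x ∈ C → g x = 0 := by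
      filter_upwards [hk, hk0] with x h1 h2 hxC
      rwa [h1, Set.indicator_of_mem hxC] at h2
    filter_upwards [h.coeFn_isometry γ g, (h.quasiMeasurePreserving (-γ)).ae hgC] with x h1 h2 hxC
    rw [← hfg, h1, h2 hxC, mul_zero]
  rw [Lp.eq_zero_iff_ae_eq_zero]
  have hc : ∀ᵐ x ∂μ, x ∉ (⋃ γ : Γ, σ γ '' C)ᶜ := measure_eq_zero_iff_ae_notMem.mp hcover
  filter_upwards [ae_all_iff.mpr hzero, hc] with x h1 h2
  obtain ⟨γ, hγ⟩ := Set.mem_iUnion.mp (not_not.mp h2)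
  exact h1 γ ((h.mem_image_iff γ C x).mp hγ)

end IsQuasiInvariantAction

end Action

/-- Let `Γ` be a countable discrete abelian group acting
measurably on a σ-finite measure space `(X, μ)` (with `L²(X)` separable) by a
quasi-`Γ`-invariant action `σ` with Jacobian `J_σ`, satisfying the tiling
property.  Let `V` be the closed span of the system `{T_σ(γ) φⱼ}`.  If `V` can
be generated by the orbit of `ℓ ≤ m` functions, then for a.e. `A ∈ ℂ^{ℓ×m}`
the functions `ψᵢ = ∑ⱼ aᵢⱼ φⱼ` satisfy
`V = closed span {T_σ(γ) ψᵢ : γ ∈ Γ, 1 ≤ i ≤ ℓ}`. -/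
theorem stmt12 {Γ X : Type*} [AddCommGroup Γ] [Countable Γ]
    [MeasurableSpace X] (μ : Measure X) [SigmaFinite μ]
    [TopologicalSpace.SeparableSpace (Lp ℂ 2 μ)]
    (σ : Γ → X → X) (hmeas : ∀ γ, Measurable (σ γ))
    (hcomp : ∀ γ γ' x, σ γ (σ γ' x) = σ (γ + γ') x)
    (hid : ∀ x, σ 0 x = x)
    (Jσ : Γ → X → ℝ) (hJmeas : ∀ γ, Measurable (Jσ γ))
    (hJpos : ∀ γ x, 0 < Jσ γ x)
    (hquasi : ∀ γ, Measure.map (σ (-γ)) μ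
      = μ.withDensity fun x => ENNReal.ofReal (Jσ γ x))
    (htiling : ∃ C : Set X, MeasurableSet C ∧
      μ ((⋃ γ : Γ, σ γ '' C)ᶜ) = 0 ∧
      ∀ γ γ' : Γ, γ ≠ γ' → μ (σ γ '' C ∩ σ γ' '' C) = 0)
    {m ℓ : ℕ} (hℓm : ℓ ≤ m) (φ : Fin m → Lp ℂ 2 μ)
    (V : Submodule ℂ (Lp ℂ 2 μ)) (hV : V = actSpan μ σ Jσ φ)
    (θ : Fin ℓ → Lp ℂ 2 μ) (hθ : V = actSpan μ σ Jσ θ) :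
    volume {A : Fin ℓ → Fin m → ℂ |
      ¬ V = actSpan μ σ Jσ fun i => ∑ j, A i j • φ j} = 0 := by
  have h : IsQuasiInvariantAction μ σ Jσ := ⟨hmeas, hcomp, hid, hJmeas, hJpos, hquasi⟩
  obtain ⟨C, hC, hcover, hdisj⟩ := htiling
  rw [hV, h.actSpan_eq_orbitSpan, h.actSpan_eq_orbitSpan] at hθ
  have hae := ae_orbitSpan_eq_of_wandering h.isometry h.isometry_zero h.isometry_isometry
    (supportedOn μ C) (h.orthogonalFamily_supportedOn hC hdisj)
    (h.eq_zero_of_orthogonal_supportedOn hC hcover) φ θ hθ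
  change ∀ᵐ A : Fin ℓ → Fin m → ℂ, V = actSpan μ σ Jσ fun i => ∑ j, A i j • φ j
  filter_upwards [hae] with A hA
  rw [hV, h.actSpan_eq_orbitSpan, h.actSpan_eq_orbitSpan, hA]
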